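/- There exists a constant C > 0, depending only on the Schottky data, such that for all C₁ ≥ 2, all τ > 0, and all x ∈ ℝ, the number of nonempty words a with τ ≤ |I_a| ≤ C₁τ and x ∈ I_a is at most C·log C₁. -/

import Mathlib

open Complex MeasureTheory Metric Set
open scoped Real

noncomputable section


abbrev SL2R := Matrix.SpecialLinearGroup (Fin 2) ℝ

/-- Entries of a matrix in `SL(2,ℝ)`, as complex numbers. -/
def mA (g : SL2R) : ℂ := ((g.1 0 0 : ℝ) : ℂ)
def mB (g : SL2R) : ℂ := ((g.1 0 1 : ℝ) : ℂ)
def mC (g : SL2R) : ℂ := ((g.1 1 0 : ℝ) : ℂ)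
def mD (g : SL2R) : ℂ := ((g.1 1 1 : ℝ) : ℂ)

/-- The Möbius action of `SL(2,ℝ)` on the Riemann sphere `ℂ ∪ {∞}`. -/
def moebius (g : SL2R) : OnePoint ℂ → OnePoint ℂ := fun z =>
  match z with
  | OnePoint.infty => if mC g = 0 then OnePoint.infty else ((mA g / mC g : ℂ) : OnePoint ℂ)
  | (w : ℂ) => if mC g * w + mD g = 0 then OnePoint.infty
      else (((mA g * w + mB g) / (mC g * w + mD g) : ℂ) : OnePoint ℂ)

/-- The Möbius action on `ℂ`, with junk value at the pole. -/
def moebiusC (g : SL2R) (z : ℂ) : ℂ := (mA g * z + mB g) / (mC g * z + mD g)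

/-- The Möbius action on `ℝ`, with junk value at the pole. -/
def moebiusR (g : SL2R) (x : ℝ) : ℝ :=
  (g.1 0 0 * x + g.1 0 1) / (g.1 1 0 * x + g.1 1 1)

/-- The complex derivative `γ'(z) = (cz+d)⁻²` of a Möbius transformation (`det = 1`). -/
def dMob (g : SL2R) (z : ℂ) : ℂ := ((mC g * z + mD g)⁻¹) ^ 2

/-- The involution `a ↦ ā` on the alphabet `{1, …, 2r}` (as `Fin (2*r)`). -/
def bar {r : ℕ} (a : Fin (2 * r)) : Fin (2 * r) :=
  if h : (a : ℕ) < r then ⟨(a : ℕ) + r, by omega⟩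
  else ⟨(a : ℕ) - r, by have := a.isLt; omega⟩

/-- Schottky data: `2r` pairwise disjoint closed disks centered on the real axis and
`2r` elements of `SL(2,ℝ)` with `γ_a((ℂ∪{∞}) \ interior D_{ā}) = D_a`, `γ_ā = γ_a⁻¹`. -/
structure Schottky (r : ℕ) where
  hr : 1 ≤ r
  center : Fin (2 * r) → ℝ
  radius : Fin (2 * r) → ℝ
  radius_pos : ∀ a, 0 < radius a
  disj : Pairwise fun a b =>
    Disjoint (closedBall ((center a : ℝ) : ℂ) (radius a)) (closedBall ((center b : ℝ) : ℂ) (radius b))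
  γ : Fin (2 * r) → SL2R
  γ_bar : ∀ a, γ (bar a) = (γ a)⁻¹
  γ_maps : ∀ a, moebius (γ a) ''
      (univ \ ((fun z : ℂ => (z : OnePoint ℂ)) '' interior (closedBall ((center (bar a) : ℝ) : ℂ) (radius (bar a)))))
    = (fun z : ℂ => (z : OnePoint ℂ)) '' closedBall ((center a : ℝ) : ℂ) (radius a)

/-- Words: finite sequences of letters with `a_{j+1} ≠ ā_j`. -/
def IsWord {r : ℕ} (w : List (Fin (2 * r))) : Prop := w.Chain' fun x y => y ≠ bar x

/-- The word `ā := ā_n ⋯ ā_1`. -/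
def barWord {r : ℕ} (w : List (Fin (2 * r))) : List (Fin (2 * r)) := (w.map bar).reverse

namespace Schottky

variable {r : ℕ} (S : Schottky r)

/-- The disk `D_a` for a letter `a`. -/
def disk (a : Fin (2 * r)) : Set ℂ := closedBall ((S.center a : ℝ) : ℂ) (S.radius a)

/-- `γ_w := γ_{a_1} ⋯ γ_{a_n}`. -/
def g (w : List (Fin (2 * r))) : SL2R := (w.map S.γ).prod

/-- The disk `D_w := γ_{w'}(D_{a_n})` of a nonempty word, as a subset of the Riemann sphere. -/
def sdisk : List (Fin (2 * r)) → Set (OnePoint ℂ)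
  | [] => ∅
  | a :: w => moebius (S.g ((a :: w).dropLast)) ''
      ((fun z : ℂ => (z : OnePoint ℂ)) '' S.disk ((a :: w).getLast (List.cons_ne_nil a w)))

/-- The disk `D_w` as a subset of `ℂ`. -/
def wdisk (w : List (Fin (2 * r))) : Set ℂ := {z : ℂ | (z : OnePoint ℂ) ∈ S.sdisk w}

/-- The interval `I_w = D_w ∩ ℝ`, as a subset of `ℝ`. -/
def wint (w : List (Fin (2 * r))) : Set ℝ := {x : ℝ | ((x : ℝ) : ℂ) ∈ S.wdisk w}

/-- The length `|I_w|` of the interval `I_w`. -/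
def wlen (w : List (Fin (2 * r))) : ℝ := Metric.diam (S.wint w)

/-- `D = ⋃_{a ∈ A} D_a`. -/
def D : Set ℂ := ⋃ a, S.disk a

/-- `I = D ∩ ℝ`, as a subset of `ℝ`. -/
def Ire : Set ℝ := {x : ℝ | ((x : ℝ) : ℂ) ∈ S.D}

/-- `D₂ = ⋃_{|w| = 2} D_w`. -/
def D₂ : Set ℂ := ⋃ (a : Fin (2 * r)), ⋃ (b : Fin (2 * r)), ⋃ (_ : b ≠ bar a), S.wdisk [a, b]

/-- `I'_a` for a letter `a`: the convex hull of `⋃_{b ≠ ā} I_{ab}`. -/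
def iprimeLetter (a : Fin (2 * r)) : Set ℝ :=
  convexHull ℝ (⋃ (b : Fin (2 * r)), ⋃ (_ : b ≠ bar a), S.wint [a, b])

/-- `I'_w := γ_{w'}(I'_{a_n})` for a nonempty word `w`. -/
def iprime : List (Fin (2 * r)) → Set ℝ
  | [] => ∅
  | a :: w => moebiusR (S.g ((a :: w).dropLast)) ''
      S.iprimeLetter ((a :: w).getLast (List.cons_ne_nil a w))

/-- The partition `Z(τ)`. -/
def Ztau (τ : ℝ) : Set (List (Fin (2 * r))) :=
  {w | w ≠ [] ∧ IsWord w ∧ S.wlen w ≤ τ ∧ (w.dropLast = [] ∨ τ < S.wlen w.dropLast)}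

/-- The limit set `Λ_Γ ⊂ ℝ`. -/
def limitSet : Set ℝ :=
  {x : ℝ | ∀ n : ℕ, 1 ≤ n → ∃ w : List (Fin (2 * r)), IsWord w ∧ w.length = n ∧ x ∈ S.wint w}

/-- The τ-neighbourhood `Λ_Γ(τ) ⊂ ℝ` of the limit set. -/
def limitSetNbhd (τ : ℝ) : Set ℝ := {x : ℝ | ∃ y ∈ S.limitSet, |x - y| ≤ τ}

end Schottky

/-- `ℓ` is a holomorphic branch on `U` of the logarithm of the derivative of the Möbius
transformation of `g`, real on `U ∩ ℝ`. -/
structure IsLogBranch (g : SL2R) (U : Set ℂ) (ℓ : ℂ → ℂ) : Prop where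
  holo : DifferentiableOn ℂ ℓ U
  exp_eq : ∀ z ∈ U, Complex.exp (ℓ z) = dMob g z
  real_on : ∀ x : ℝ, ((x : ℝ) : ℂ) ∈ U → (ℓ ((x : ℝ) : ℂ)).im = 0

/-- A family of branches `ℓ a b` of `log γ_a'` on `D_b`, for all `a ≠ b̄`. -/
def IsBranchFamily {r : ℕ} (S : Schottky r) (ℓ : Fin (2 * r) → Fin (2 * r) → ℂ → ℂ) : Prop :=
  ∀ a b : Fin (2 * r), a ≠ bar b → IsLogBranch (S.γ a) (S.disk b) (ℓ a b)

/-- The fixed-point equation `L_s u = u` on the interior of `D`, written pointwise. -/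
def TransferFixed {r : ℕ} (S : Schottky r) (s : ℂ)
    (ℓ : Fin (2 * r) → Fin (2 * r) → ℂ → ℂ) (u : ℂ → ℂ) : Prop :=
  ∀ b : Fin (2 * r), ∀ z ∈ interior (S.disk b),
    u z = ∑ a : Fin (2 * r), if a ≠ bar b then
      Complex.exp (s * ℓ a b z) * u (moebiusC (S.γ a) z) else 0

/-- The transfer operator `L_s`, as an operator on functions. -/
def transferOp {r : ℕ} (S : Schottky r) (s : ℂ)
    (ℓ : Fin (2 * r) → Fin (2 * r) → ℂ → ℂ) (u : ℂ → ℂ) : ℂ → ℂ := fun z =>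
  ∑ b : Fin (2 * r), (S.disk b).indicator
    (fun w => ∑ a : Fin (2 * r), if a ≠ bar b then
      Complex.exp (s * ℓ a b w) * u (moebiusC (S.γ a) w) else 0) z

/-- A partition: a finite set of nonempty words such that every long enough word
has exactly one prefix in it. -/
def IsPartition {r : ℕ} (S : Schottky r) (Z : Finset (List (Fin (2 * r)))) : Prop :=
  (∀ w ∈ Z, w ≠ [] ∧ IsWord w) ∧
  ∃ N : ℕ, ∀ w : List (Fin (2 * r)), IsWord w → N ≤ w.length →
    ∃! p : List (Fin (2 * r)), p ∈ Z ∧ p <+: w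


/-- The denominator `cx + d` of the Möbius action on the real line. -/
def realDen (g : SL2R) (x : ℝ) : ℝ := g.1 1 0 * x + g.1 1 1

lemma SL2R.det_eq (g : SL2R) : g.1 0 0 * g.1 1 1 - g.1 0 1 * g.1 1 0 = 1 := by
  rw [← Matrix.det_fin_two]; exact g.2

lemma realDen_mul (g h : SL2R) (x : ℝ) (hx : realDen h x ≠ 0) :
    realDen (g * h) x = realDen g (moebiusR h x) * realDen h x := by
  have e : moebiusR h x * realDen h x = h.1 0 0 * x + h.1 0 1 := div_mul_cancel₀ _ hx
  simp only [realDen, Matrix.SpecialLinearGroup.coe_mul, Matrix.mul_apply, Fin.sum_univ_two] at *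
  linear_combination (-(g.1 1 0)) * e

lemma moebiusR_mul (g h : SL2R) (x : ℝ) (hx : realDen h x ≠ 0) :
    moebiusR (g * h) x = moebiusR g (moebiusR h x) := by
  have e : moebiusR h x * realDen h x = h.1 0 0 * x + h.1 0 1 := div_mul_cancel₀ _ hx
  have e2 := realDen_mul g h x hx
  have e3 : (g * h).1 0 0 * x + (g * h).1 0 1
      = (g.1 0 0 * moebiusR h x + g.1 0 1) * realDen h x := by
    simp only [realDen, Matrix.SpecialLinearGroup.coe_mul, Matrix.mul_apply,
      Fin.sum_univ_two] at *
    linear_combination (-(g.1 0 0)) * e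
  calc moebiusR (g * h) x = ((g * h).1 0 0 * x + (g * h).1 0 1) / realDen (g * h) x := rfl
    _ = _ := by rw [e3, e2, mul_div_mul_right _ _ hx]; rfl

lemma moebiusR_sub (g : SL2R) (x y : ℝ) (hx : realDen g x ≠ 0) (hy : realDen g y ≠ 0) :
    moebiusR g y - moebiusR g x = (y - x) / (realDen g x * realDen g y) := by
  have hdet := g.det_eq
  change (g.1 0 0 * y + g.1 0 1) / realDen g y - (g.1 0 0 * x + g.1 0 1) / realDen g x = _
  rw [div_sub_div _ _ hy hx, mul_comm (realDen g x)]
  congr 1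
  simp only [realDen]
  linear_combination (y - x) * hdet

lemma moebiusR_inj (g : SL2R) (x y : ℝ) (hx : realDen g x ≠ 0) (hy : realDen g y ≠ 0)
    (h : moebiusR g x = moebiusR g y) : x = y := by
  have h1 := moebiusR_sub g x y hx hy
  rw [h, sub_self, eq_comm, div_eq_zero_iff] at h1
  rcases h1 with h1 | h1
  · linarith
  · exact absurd h1 (mul_ne_zero hx hy)

lemma realDen_mul_pos (g : SL2R) {s t : ℝ} (hst : s ≤ t)
    (h : ∀ y ∈ Icc s t, realDen g y ≠ 0) : 0 < realDen g s * realDen g t := by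
  by_contra! hneg
  have hcont : ContinuousOn (realDen g) (Icc s t) := by unfold realDen; fun_prop
  rcases mul_nonpos_iff.1 hneg with ⟨h1, h2⟩ | ⟨h1, h2⟩
  · obtain ⟨y, hy, hy0⟩ := intermediate_value_Icc' hst hcont ⟨h2, h1⟩
    exact h y hy hy0
  · obtain ⟨y, hy, hy0⟩ := intermediate_value_Icc hst hcont ⟨h1, h2⟩
    exact h y hy hy0

lemma moebiusR_lt (g : SL2R) {s t : ℝ} (hst : s < t)
    (h : ∀ y ∈ Icc s t, realDen g y ≠ 0) : moebiusR g s < moebiusR g t := by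
  have := moebiusR_sub g s t (h s ⟨le_rfl, hst.le⟩) (h t ⟨hst.le, le_rfl⟩)
  have h2 := div_pos (sub_pos.2 hst) (realDen_mul_pos g hst.le h)
  linarith

lemma moebiusR_le (g : SL2R) {s t : ℝ} (hst : s ≤ t)
    (h : ∀ y ∈ Icc s t, realDen g y ≠ 0) : moebiusR g s ≤ moebiusR g t := by
  rcases hst.eq_or_lt with rfl | h1
  · exact le_rfl
  · exact (moebiusR_lt g h1 h).le

/-- Removing a proportion `δ` at both ends of an interval removes at least a proportion `δ` of
the image interval under a Möbius map with pole outside the interval. -/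
lemma moebiusR_sub_le (g : SL2R) {x₀ x₁ y₀ y₁ δ : ℝ} (hδ : 0 < δ) (hx : x₀ < x₁)
    (h : ∀ y ∈ Icc x₀ x₁, realDen g y ≠ 0) (hy : y₀ ≤ y₁)
    (h0 : x₀ + δ * (x₁ - x₀) ≤ y₀) (h1 : y₁ ≤ x₁ - δ * (x₁ - x₀)) :
    moebiusR g y₁ - moebiusR g y₀ ≤ (1 - δ) * (moebiusR g x₁ - moebiusR g x₀) := by
  have hL : 0 < δ * (x₁ - x₀) := mul_pos hδ (sub_pos.2 hx)
  have sub : ∀ {s t : ℝ}, x₀ ≤ s → t ≤ x₁ → ∀ y ∈ Icc s t, realDen g y ≠ 0 :=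
    fun hs ht y hy => h y ⟨hs.trans hy.1, hy.2.trans ht⟩
  have n : ∀ {s : ℝ}, x₀ ≤ s → s ≤ x₁ → realDen g s ≠ 0 := fun hs ht => h _ ⟨hs, ht⟩
  have hP := realDen_mul_pos g hx.le h
  have a0 : x₀ ≤ y₀ := by linarith
  have a1 : y₀ ≤ x₁ := by linarith
  have b0 : x₀ ≤ y₁ := by linarith
  have b1 : y₁ ≤ x₁ := by linarith
  have m0 := moebiusR_le g a0 (sub le_rfl a1)
  have m1 := moebiusR_le g b1 (sub b0 le_rfl)
  have e := moebiusR_sub g x₀ x₁ (n le_rfl hx.le) (n hx.le le_rfl)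
  have e0 := moebiusR_sub g x₀ y₀ (n le_rfl hx.le) (n a0 a1)
  have e1 := moebiusR_sub g y₁ x₁ (n b0 b1) (n hx.le le_rfl)
  have p0 := realDen_mul_pos g a0 (sub le_rfl a1)
  have p1 := realDen_mul_pos g b1 (sub b0 le_rfl)
  have key : realDen g x₀ * realDen g y₀ ≤ realDen g x₀ * realDen g x₁ ∨
      realDen g y₁ * realDen g x₁ ≤ realDen g x₀ * realDen g x₁ := by
    have d0 : realDen g x₀ * realDen g x₁ - realDen g x₀ * realDen g y₀
        = (realDen g x₀ * g.1 1 0) * (x₁ - y₀) := by simp only [realDen]; ring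
    have d1 : realDen g x₀ * realDen g x₁ - realDen g y₁ * realDen g x₁
        = (- (realDen g x₁ * g.1 1 0)) * (y₁ - x₀) := by simp only [realDen]; ring
    rcases le_total 0 (realDen g x₀ * g.1 1 0) with hc | hc
    · left
      have := mul_nonneg hc (sub_nonneg.2 a1)
      linarith
    · right
      have h3 : realDen g x₁ * g.1 1 0 ≤ 0 := by
        by_contra! h4
        have h5 : (realDen g x₀ * g.1 1 0) * (realDen g x₁ * g.1 1 0) ≤ 0 :=
          mul_nonpos_of_nonpos_of_nonneg hc h4.le
        have h6 : g.1 1 0 ≠ 0 := by intro h7; simp [h7] at h4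
        have h8 := mul_pos hP (sq_pos_of_ne_zero h6)
        nlinarith
      have := mul_nonneg (neg_nonneg.2 h3) (sub_nonneg.2 b0)
      linarith
  rcases key with k | k
  · have : δ * (x₁ - x₀) / (realDen g x₀ * realDen g x₁)
        ≤ (y₀ - x₀) / (realDen g x₀ * realDen g y₀) :=
      div_le_div₀ (by linarith) (by linarith) p0 k
    rw [mul_div_assoc, ← e, ← e0] at this
    linarith
  · have : δ * (x₁ - x₀) / (realDen g x₀ * realDen g x₁)
        ≤ (x₁ - y₁) / (realDen g y₁ * realDen g x₁) :=
      div_le_div₀ (by linarith) (by linarith) p1 k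
    rw [mul_div_assoc, ← e, ← e1] at this
    linarith

lemma ofReal_realDen (g : SL2R) (x : ℝ) : mC g * x + mD g = (realDen g x : ℂ) := by
  simp [mC, mD, realDen]

lemma ofReal_moebiusR (g : SL2R) (x : ℝ) :
    ((moebiusR g x : ℝ) : ℂ) = (mA g * x + mB g) / (mC g * x + mD g) := by
  simp [mA, mB, mC, mD, moebiusR]

lemma moebius_coe_eq_coe (g : SL2R) (z w : ℂ) : moebius g (z : OnePoint ℂ) = (w : OnePoint ℂ) ↔
    mC g * z + mD g ≠ 0 ∧ (mA g * z + mB g) / (mC g * z + mD g) = w := by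
  change (if mC g * z + mD g = 0 then OnePoint.infty
      else (((mA g * z + mB g) / (mC g * z + mD g) : ℂ) : OnePoint ℂ)) = _ ↔ _
  split_ifs with h
  · simp [h]
  · simp [h]

lemma moebius_ofReal_eq_ofReal (g : SL2R) (x y : ℝ) :
    moebius g ((x : ℂ) : OnePoint ℂ) = ((y : ℂ) : OnePoint ℂ) ↔
      realDen g x ≠ 0 ∧ moebiusR g x = y := by
  rw [moebius_coe_eq_coe, ← ofReal_moebiusR, ofReal_realDen]
  norm_cast

/-- Points that a real Möbius map sends to the real line are real. -/
lemma im_eq_zero_of_moebius_eq_ofReal (g : SL2R) (z : ℂ) (x : ℝ)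
    (h : moebius g (z : OnePoint ℂ) = ((x : ℂ) : OnePoint ℂ)) : z.im = 0 := by
  obtain ⟨h0, h1⟩ := (moebius_coe_eq_coe g z x).1 h
  rw [div_eq_iff h0] at h1
  have hre := congrArg Complex.re h1
  have him := congrArg Complex.im h1
  simp [mA, mB, mC, mD] at hre him
  by_contra hz
  have ha : g.1 0 0 = x * g.1 1 0 := by
    apply mul_right_cancel₀ hz
    linear_combination him
  have hb : g.1 0 1 = x * g.1 1 1 := by linear_combination hre - z.re * ha
  have := g.det_eq
  rw [ha, hb] at this
  have h4 : (0 : ℝ) = 1 := by linear_combination this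
  exact zero_ne_one h4

namespace Schottky

variable {r : ℕ} (S : Schottky r)

/-- The interval `I_a` for a letter `a`. -/
def ival (a : Fin (2 * r)) : Set ℝ := Icc (S.center a - S.radius a) (S.center a + S.radius a)

lemma mem_ival {a : Fin (2 * r)} {x : ℝ} : x ∈ S.ival a ↔ |x - S.center a| ≤ S.radius a := by
  rw [ival, mem_Icc, abs_le]
  constructor <;> rintro ⟨h1, h2⟩ <;> constructor <;> linarith

lemma ofReal_mem_disk {a : Fin (2 * r)} {x : ℝ} : (x : ℂ) ∈ S.disk a ↔ x ∈ S.ival a := by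
  rw [mem_ival, disk, mem_closedBall, Complex.dist_of_im_eq (by simp)]
  simp [Real.dist_eq]

lemma ival_disjoint {a b : Fin (2 * r)} (h : a ≠ b) {x : ℝ} (ha : x ∈ S.ival a) :
    x ∉ S.ival b := fun hb =>
  Set.disjoint_left.1 (S.disj h) (S.ofReal_mem_disk.2 ha) (S.ofReal_mem_disk.2 hb)

lemma eq_of_mem_ival {a b : Fin (2 * r)} {x : ℝ} (ha : x ∈ S.ival a) (hb : x ∈ S.ival b) :
    a = b := by
  by_contra h
  exact S.ival_disjoint h ha hb

lemma gamma_maps_real (a : Fin (2 * r)) {x : ℝ}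
    (hx : S.radius (bar a) ≤ |x - S.center (bar a)|) :
    realDen (S.γ a) x ≠ 0 ∧ moebiusR (S.γ a) x ∈ S.ival a := by
  have hmem : moebius (S.γ a) ((x : ℂ) : OnePoint ℂ) ∈
      (fun z : ℂ => (z : OnePoint ℂ)) '' closedBall ((S.center a : ℝ) : ℂ) (S.radius a) := by
    rw [← S.γ_maps a]
    refine mem_image_of_mem _ ⟨mem_univ _, ?_⟩
    rintro ⟨z, hz, hzx⟩
    obtain rfl : z = x := by simpa using hzx
    rw [interior_closedBall _ (S.radius_pos _).ne', mem_ball, Complex.dist_of_im_eq (by simp)] at hz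
    simp only [Complex.ofReal_re, Real.dist_eq] at hz
    linarith
  obtain ⟨z, hz, hzx⟩ := hmem
  obtain ⟨h0, h1⟩ := (moebius_coe_eq_coe (S.γ a) x z).1 hzx.symm
  rw [← ofReal_moebiusR] at h1
  rw [ofReal_realDen] at h0
  refine ⟨by exact_mod_cast h0, ?_⟩
  rw [← ofReal_mem_disk, h1]
  exact hz

lemma gamma_maps_ival {a b : Fin (2 * r)} (hab : b ≠ bar a) {x : ℝ} (hx : x ∈ S.ival b) :
    realDen (S.γ a) x ≠ 0 ∧ moebiusR (S.γ a) x ∈ S.ival a := by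
  apply S.gamma_maps_real
  have := S.ival_disjoint hab hx
  rw [mem_ival] at this
  linarith

lemma exists_thickened_ival {b c : Fin (2 * r)} (h : b ≠ c) : ∃ ε > 0,
    ∀ t ∈ Icc (S.center b - S.radius b - ε) (S.center b + S.radius b + ε),
      S.radius c ≤ |t - S.center c| := by
  have hb := S.radius_pos b
  have hc := S.radius_pos c
  by_cases h1 : S.center b + S.radius b < S.center c - S.radius c
  · refine ⟨S.center c - S.radius c - (S.center b + S.radius b), by linarith, fun t ht => ?_⟩
    rw [le_abs]; right; linarith [ht.2]
  by_cases h2 : S.center c + S.radius c < S.center b - S.radius b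
  · refine ⟨S.center b - S.radius b - (S.center c + S.radius c), by linarith, fun t ht => ?_⟩
    rw [le_abs]; left; linarith [ht.1]
  · exfalso
    push Not at h1 h2
    refine S.ival_disjoint h (x := max (S.center b - S.radius b) (S.center c - S.radius c))
      ⟨le_max_left _ _, max_le (by linarith) h1⟩ ⟨le_max_right _ _, max_le h2 (by linarith)⟩

lemma gamma_ival_strict {a b : Fin (2 * r)} (hab : b ≠ bar a) :
    S.center a - S.radius a < moebiusR (S.γ a) (S.center b - S.radius b) ∧
      moebiusR (S.γ a) (S.center b + S.radius b) < S.center a + S.radius a := by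
  have hb := S.radius_pos b
  obtain ⟨ε, hε, h⟩ := S.exists_thickened_ival hab
  constructor
  · refine lt_of_le_of_lt (S.gamma_maps_real a (h (S.center b - S.radius b - ε)
      ⟨le_rfl, by linarith⟩)).2.1 (moebiusR_lt _ (by linarith) fun y hy => ?_)
    exact (S.gamma_maps_real a (h y ⟨hy.1, by linarith [hy.2]⟩)).1
  · refine lt_of_lt_of_le (moebiusR_lt _ (t := S.center b + S.radius b + ε)
      (by linarith) fun y hy => ?_)
      (S.gamma_maps_real a (h (S.center b + S.radius b + ε) ⟨by linarith, le_rfl⟩)).2.2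
    exact (S.gamma_maps_real a (h y ⟨by linarith [hy.1], hy.2⟩)).1

/-- A uniform relative margin of `I_{ab}` inside `I_a`. -/
lemma exists_margin : ∃ δ > 0, δ < 1 ∧ ∀ a b : Fin (2 * r), b ≠ bar a →
    S.center a - S.radius a + δ * (2 * S.radius a)
        ≤ moebiusR (S.γ a) (S.center b - S.radius b) ∧
      moebiusR (S.γ a) (S.center b + S.radius b)
        ≤ S.center a + S.radius a - δ * (2 * S.radius a) := by
  have hpair : ∀ p : Fin (2 * r) × Fin (2 * r), ∃ δ > 0, p.2 ≠ bar p.1 →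
      S.center p.1 - S.radius p.1 + δ * (2 * S.radius p.1)
          ≤ moebiusR (S.γ p.1) (S.center p.2 - S.radius p.2) ∧
        moebiusR (S.γ p.1) (S.center p.2 + S.radius p.2)
          ≤ S.center p.1 + S.radius p.1 - δ * (2 * S.radius p.1) := by
    rintro ⟨a, b⟩
    by_cases hab : b = bar a
    · exact ⟨1, one_pos, fun h => absurd hab h⟩
    obtain ⟨h1, h2⟩ := S.gamma_ival_strict hab
    have ha : 0 < 2 * S.radius a := by linarith [S.radius_pos a]
    refine ⟨min ((moebiusR (S.γ a) (S.center b - S.radius b) - (S.center a - S.radius a))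
        / (2 * S.radius a)) ((S.center a + S.radius a - moebiusR (S.γ a)
        (S.center b + S.radius b)) / (2 * S.radius a)),
      lt_min (div_pos (by linarith) ha) (div_pos (by linarith) ha), fun _ => ⟨?_, ?_⟩⟩
    · have := (le_div_iff₀ ha).1 (min_le_left ((moebiusR (S.γ a) (S.center b - S.radius b)
        - (S.center a - S.radius a)) / (2 * S.radius a)) ((S.center a + S.radius a
        - moebiusR (S.γ a) (S.center b + S.radius b)) / (2 * S.radius a)))
      linarith
    · have := (le_div_iff₀ ha).1 (min_le_right ((moebiusR (S.γ a) (S.center b - S.radius b)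
        - (S.center a - S.radius a)) / (2 * S.radius a)) ((S.center a + S.radius a
        - moebiusR (S.γ a) (S.center b + S.radius b)) / (2 * S.radius a)))
      linarith
  choose d hd hdp using hpair
  have : Nonempty (Fin (2 * r) × Fin (2 * r)) :=
    ⟨(⟨0, by linarith [S.hr]⟩, ⟨0, by linarith [S.hr]⟩)⟩
  obtain ⟨p₀, hp₀⟩ := Finite.exists_min d
  refine ⟨min (d p₀) (1 / 2), lt_min (hd _) (by norm_num),
    (min_le_right _ _).trans_lt (by norm_num), fun a b hab => ?_⟩
  obtain ⟨h1, h2⟩ := hdp (a, b) hab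
  have ha := S.radius_pos a
  have : min (d p₀) (1 / 2) * (2 * S.radius a) ≤ d (a, b) * (2 * S.radius a) :=
    mul_le_mul_of_nonneg_right ((min_le_left _ _).trans (hp₀ _)) (by linarith)
  constructor <;> simp only at h1 h2 <;> linarith

lemma g_cons (a : Fin (2 * r)) (u : List (Fin (2 * r))) : S.g (a :: u) = S.γ a * S.g u := by
  simp [g]

lemma g_concat (u : List (Fin (2 * r))) (a : Fin (2 * r)) :
    S.g (u ++ [a]) = S.g u * S.γ a := by
  simp [g]

lemma realDen_one (x : ℝ) : realDen 1 x = 1 := by simp [realDen]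

lemma moebiusR_one (x : ℝ) : moebiusR 1 x = x := by simp [moebiusR]

lemma sdisk_concat (u : List (Fin (2 * r))) (b : Fin (2 * r)) :
    S.sdisk (u ++ [b]) = moebius (S.g u) '' ((fun z : ℂ => (z : OnePoint ℂ)) '' S.disk b) := by
  have h : ∀ (w : List (Fin (2 * r))) (hw : w ≠ []), S.sdisk w = moebius (S.g w.dropLast) ''
      ((fun z : ℂ => (z : OnePoint ℂ)) '' S.disk (w.getLast hw)) := by
    rintro (_ | ⟨a, w⟩) hw
    · exact absurd rfl hw
    · rfl
  rw [h _ (by simp)]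
  simp

lemma mem_wint_concat {u : List (Fin (2 * r))} {b : Fin (2 * r)} {x : ℝ} :
    x ∈ S.wint (u ++ [b]) ↔
      ∃ y ∈ S.ival b, realDen (S.g u) y ≠ 0 ∧ moebiusR (S.g u) y = x := by
  change (((x : ℝ) : ℂ) : OnePoint ℂ) ∈ S.sdisk (u ++ [b]) ↔ _
  rw [sdisk_concat]
  constructor
  · rintro ⟨_, ⟨z, hz, rfl⟩, hzx⟩
    have him := im_eq_zero_of_moebius_eq_ofReal _ _ _ hzx
    lift z to ℝ using him
    exact ⟨z, S.ofReal_mem_disk.1 hz, (moebius_ofReal_eq_ofReal _ _ _).1 hzx⟩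
  · rintro ⟨y, hy, h⟩
    exact ⟨_, ⟨y, S.ofReal_mem_disk.2 hy, rfl⟩, (moebius_ofReal_eq_ofReal _ _ _).2 h⟩

lemma word_maps (u : List (Fin (2 * r))) (b : Fin (2 * r)) (hw : IsWord (u ++ [b])) {y : ℝ}
    (hy : y ∈ S.ival b) : realDen (S.g u) y ≠ 0 ∧
      ∀ a ∈ (u ++ [b]).head?, moebiusR (S.g u) y ∈ S.ival a := by
  induction u with
  | nil => simpa [g, realDen_one, moebiusR_one] using hy
  | cons a u ih =>
    rw [List.cons_append] at hw
    obtain ⟨hhead, htail⟩ := List.isChain_cons.1 hw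
    obtain ⟨h0, h1⟩ := ih htail
    obtain ⟨c, hc⟩ : ∃ c, c ∈ (u ++ [b]).head? := by
      cases u <;> simp
    obtain ⟨h2, h3⟩ := S.gamma_maps_ival (hhead c hc) (h1 c hc)
    rw [g_cons, realDen_mul _ _ _ h0, moebiusR_mul _ _ _ h0]
    refine ⟨mul_ne_zero h2 h0, fun a' ha' => ?_⟩
    obtain rfl : a = a' := by simpa using ha'
    exact h3

lemma wint_cons_subset {a : Fin (2 * r)} {w : List (Fin (2 * r))} (hw : IsWord (a :: w)) :
    S.wint (a :: w) ⊆ S.ival a := by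
  obtain ⟨u, b, hub⟩ := List.eq_nil_or_concat' (a :: w) |>.resolve_left (by simp)
  rw [hub] at hw ⊢
  intro x hx
  obtain ⟨y, hy, -, rfl⟩ := S.mem_wint_concat.1 hx
  exact (S.word_maps u b hw hy).2 a (by simp [← hub])

lemma exists_of_mem_wint_cons {a : Fin (2 * r)} {w : List (Fin (2 * r))} (hne : w ≠ [])
    (hw : IsWord (a :: w)) {x : ℝ} (hx : x ∈ S.wint (a :: w)) :
    ∃ y ∈ S.wint w, realDen (S.γ a) y ≠ 0 ∧ moebiusR (S.γ a) y = x := by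
  obtain ⟨u, b, rfl⟩ := List.eq_nil_or_concat' w |>.resolve_left hne
  rw [← List.cons_append] at hx
  obtain ⟨y, hy, h0, h1⟩ := S.mem_wint_concat.1 hx
  have h2 := (S.word_maps u b (List.isChain_cons.1 hw).2 hy).1
  rw [g_cons] at h0 h1
  rw [realDen_mul _ _ _ h2] at h0
  rw [moebiusR_mul _ _ _ h2] at h1
  exact ⟨_, S.mem_wint_concat.2 ⟨y, hy, h2, rfl⟩, left_ne_zero_of_mul h0, h1⟩

/-- The words whose intervals contain a given point form a chain for the prefix order. -/
lemma prefix_of_mem_wint {w v : List (Fin (2 * r))} (hw0 : w ≠ []) (hw : IsWord w)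
    (hv : IsWord v) (hlen : w.length ≤ v.length) {x : ℝ} (hxw : x ∈ S.wint w)
    (hxv : x ∈ S.wint v) : w <+: v := by
  induction w generalizing v x with
  | nil => exact absurd rfl hw0
  | cons a w ih =>
    cases v with
    | nil => simp at hlen
    | cons b v =>
      obtain rfl := S.eq_of_mem_ival (S.wint_cons_subset hw hxw) (S.wint_cons_subset hv hxv)
      rw [List.prefix_cons_inj]
      rcases eq_or_ne w [] with rfl | hne
      · exact List.nil_prefix
      have hne' : v ≠ [] := by
        rintro rfl
        simp at hlen
        exact hne hlen
      obtain ⟨y, hy, hy0, hyx⟩ := S.exists_of_mem_wint_cons hne hw hxw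
      obtain ⟨y', hy', hy0', hyx'⟩ := S.exists_of_mem_wint_cons hne' hv hxv
      obtain rfl := moebiusR_inj _ _ _ hy0 hy0' (hyx.trans hyx'.symm)
      exact ih hne (List.isChain_cons.1 hw).2 (List.isChain_cons.1 hv).2 (by simpa using hlen)
        hy hy'

lemma wlen_concat {u : List (Fin (2 * r))} {b : Fin (2 * r)} (hw : IsWord (u ++ [b])) :
    S.wlen (u ++ [b]) = moebiusR (S.g u) (S.center b + S.radius b)
      - moebiusR (S.g u) (S.center b - S.radius b) := by
  have hb := S.radius_pos b
  have hden : ∀ y ∈ S.ival b, realDen (S.g u) y ≠ 0 := fun y hy => (S.word_maps u b hw hy).1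
  have hlo : S.center b - S.radius b ∈ S.ival b := ⟨le_rfl, by linarith⟩
  have hhi : S.center b + S.radius b ∈ S.ival b := ⟨by linarith, le_rfl⟩
  have hsub : S.wint (u ++ [b]) ⊆ Icc (moebiusR (S.g u) (S.center b - S.radius b))
      (moebiusR (S.g u) (S.center b + S.radius b)) := by
    intro x hx
    obtain ⟨y, hy, -, rfl⟩ := S.mem_wint_concat.1 hx
    exact ⟨moebiusR_le _ hy.1 fun t ht => hden t ⟨ht.1, ht.2.trans hy.2⟩,
      moebiusR_le _ hy.2 fun t ht => hden t ⟨hy.1.trans ht.1, ht.2⟩⟩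
  have hle : moebiusR (S.g u) (S.center b - S.radius b)
      ≤ moebiusR (S.g u) (S.center b + S.radius b) := moebiusR_le _ (by linarith) hden
  apply le_antisymm
  · refine (Metric.diam_mono hsub (isBounded_Icc _ _)).trans_eq (Real.diam_Icc hle)
  · have := Metric.dist_le_diam_of_mem ((isBounded_Icc _ _).subset hsub)
      (S.mem_wint_concat.2 ⟨_, hhi, hden _ hhi, rfl⟩)
      (S.mem_wint_concat.2 ⟨_, hlo, hden _ hlo, rfl⟩)
    rwa [Real.dist_eq, abs_of_nonneg (by linarith)] at this

/-- Intervals of words shrink at a uniform rate when a letter is appended. -/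
lemma exists_contraction : ∃ q : ℝ, 0 < q ∧ q < 1 ∧ ∀ (w : List (Fin (2 * r)))
    (b : Fin (2 * r)), w ≠ [] → IsWord (w ++ [b]) → S.wlen (w ++ [b]) ≤ q * S.wlen w := by
  obtain ⟨δ, hδ, hδ1, hmargin⟩ := S.exists_margin
  refine ⟨1 - δ, by linarith, by linarith, fun w b hne hw => ?_⟩
  obtain ⟨u, a, rfl⟩ := List.eq_nil_or_concat' w |>.resolve_left hne
  have hwa : IsWord (u ++ [a]) := (List.isChain_append.1 hw).1
  have hab : b ≠ bar a := (List.isChain_append.1 hw).2.2 a (by simp) b (by simp)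
  have hden : ∀ y ∈ S.ival a, realDen (S.g u) y ≠ 0 := fun y hy => (S.word_maps u a hwa hy).1
  have ha := S.radius_pos a
  have hb := S.radius_pos b
  have hlo : S.center b - S.radius b ∈ S.ival b := ⟨le_rfl, by linarith⟩
  have hhi : S.center b + S.radius b ∈ S.ival b := ⟨by linarith, le_rfl⟩
  rw [S.wlen_concat hw, S.wlen_concat hwa, g_concat,
    moebiusR_mul _ _ _ (S.gamma_maps_ival hab hlo).1,
    moebiusR_mul _ _ _ (S.gamma_maps_ival hab hhi).1]
  obtain ⟨h0, h1⟩ := hmargin a b hab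
  have e : S.center a + S.radius a - (S.center a - S.radius a) = 2 * S.radius a := by ring
  exact moebiusR_sub_le _ hδ (by linarith) hden
    (moebiusR_le _ (by linarith) fun y hy => (S.gamma_maps_ival hab hy).1)
    (by rwa [e]) (by rwa [e])

lemma wlen_append_le {q : ℝ} (hq : 0 < q) (hcontr : ∀ (w : List (Fin (2 * r)))
      (b : Fin (2 * r)), w ≠ [] → IsWord (w ++ [b]) → S.wlen (w ++ [b]) ≤ q * S.wlen w)
    {w : List (Fin (2 * r))} (hw0 : w ≠ []) (v : List (Fin (2 * r))) (hw : IsWord (w ++ v)) :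
    S.wlen (w ++ v) ≤ q ^ v.length * S.wlen w := by
  induction v using List.reverseRecOn with
  | nil => simp
  | append_singleton v b ih =>
    rw [← List.append_assoc] at hw ⊢
    calc S.wlen (w ++ v ++ [b]) ≤ q * S.wlen (w ++ v) := hcontr _ _ (by simp [hw0]) hw
      _ ≤ q * (q ^ v.length * S.wlen w) :=
        mul_le_mul_of_nonneg_left (ih (List.isChain_append.1 hw).1) hq.le
      _ = _ := by rw [List.length_append, List.length_singleton, pow_succ]; ring

end Schottky

/-- There is `C > 0` depending only on the Schottky data such that for all
`C₁ ≥ 2`, `τ > 0` and `x ∈ ℝ`, the number of nonempty words `w` with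
`τ ≤ |I_w| ≤ C₁τ` and `x ∈ I_w` is at most `C log C₁`. -/
theorem stmt1 {r : ℕ} (S : Schottky r) :
    ∃ C : ℝ, 0 < C ∧ ∀ C₁ : ℝ, 2 ≤ C₁ → ∀ τ : ℝ, 0 < τ → ∀ x : ℝ,
      {w : List (Fin (2 * r)) |
        w ≠ [] ∧ IsWord w ∧ τ ≤ S.wlen w ∧ S.wlen w ≤ C₁ * τ ∧ x ∈ S.wint w}.Finite ∧
      (Nat.card {w : List (Fin (2 * r)) |
        w ≠ [] ∧ IsWord w ∧ τ ≤ S.wlen w ∧ S.wlen w ≤ C₁ * τ ∧ x ∈ S.wint w} : ℝ)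
        ≤ C * Real.log C₁ := by
  obtain ⟨q, hq, hq1, hcontr⟩ := S.exists_contraction
  have hlq : 0 < -Real.log q := neg_pos.2 (Real.log_neg hq hq1)
  have hl2 : 0 < Real.log 2 := Real.log_pos (by norm_num)
  refine ⟨1 / Real.log 2 + 1 / -Real.log q, by positivity, fun C₁ hC₁ τ hτ x => ?_⟩
  have hlC : Real.log 2 ≤ Real.log C₁ := Real.log_le_log (by norm_num) hC₁
  set W : Set (List (Fin (2 * r))) := {w : List (Fin (2 * r)) |
        w ≠ [] ∧ IsWord w ∧ τ ≤ S.wlen w ∧ S.wlen w ≤ C₁ * τ ∧ x ∈ S.wint w} with hW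
  rcases W.eq_empty_or_nonempty with hemp | hne
  · rw [hemp]
    refine ⟨finite_empty, ?_⟩
    simp only [Nat.card_eq_fintype_card, Fintype.card_of_isEmpty, Nat.cast_zero]
    exact mul_nonneg (by positivity) (hl2.le.trans hlC)
  obtain ⟨w₀, hw₀, hmin⟩ := WellFounded.has_min (measure List.length).wf W hne
  have hmin' : ∀ w ∈ W, w₀.length ≤ w.length := fun w hw => not_lt.1 (hmin w hw)
  set N : ℕ := ⌊Real.log C₁ / -Real.log q⌋₊ with hN
  have hmaps : MapsTo List.length W (Finset.Icc w₀.length (w₀.length + N) : Finset ℕ) := by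
    intro w hw
    rw [Finset.coe_Icc]
    refine ⟨hmin' w hw, ?_⟩
    obtain ⟨v, rfl⟩ := S.prefix_of_mem_wint hw₀.1 hw₀.2.1 hw.2.1 (hmin' w hw)
      hw₀.2.2.2.2 hw.2.2.2.2
    rw [List.length_append]
    refine Nat.add_le_add_left (Nat.le_floor ?_) _
    have h1 : τ ≤ q ^ v.length * (C₁ * τ) :=
      hw.2.2.1.trans <| (S.wlen_append_le hq hcontr hw₀.1 v hw.2.1).trans <|
        mul_le_mul_of_nonneg_left hw₀.2.2.2.1 (by positivity)
    have h2 : 1 ≤ q ^ v.length * C₁ := by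
      rw [← mul_assoc] at h1
      exact le_of_mul_le_mul_right (by rwa [one_mul]) hτ
    have h3 := Real.log_le_log one_pos h2
    rw [Real.log_one, Real.log_mul (by positivity) (by linarith), Real.log_pow] at h3
    rw [le_div_iff₀ hlq]
    linarith
  have hinj : InjOn List.length W := fun w hw v hv h =>
    (S.prefix_of_mem_wint hw.1 hw.2.1 hv.2.1 h.le hw.2.2.2.2 hv.2.2.2.2).eq_of_length h
  refine ⟨Finite.of_injOn hmaps hinj (Finset.finite_toSet _), ?_⟩
  have hcard : Nat.card W ≤ N + 1 := by
    have h := ncard_le_ncard_of_injOn _ hmaps hinj (Finset.finite_toSet _)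
    rw [ncard_coe_finset, Nat.card_Icc] at h
    rw [Nat.card_coe_set_eq]
    omega
  have hfl : (N : ℝ) ≤ Real.log C₁ / -Real.log q :=
    Nat.floor_le (div_nonneg (hl2.le.trans hlC) hlq.le)
  have h1 : 1 ≤ Real.log C₁ / Real.log 2 := (one_le_div hl2).2 hlC
  calc (Nat.card W : ℝ) ≤ N + 1 := by exact_mod_cast hcard
    _ ≤ Real.log C₁ / -Real.log q + Real.log C₁ / Real.log 2 := add_le_add hfl h1
    _ = _ := by ring
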